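/- arXiv:2206.03137 — 10 statements merged into one kernel-verified Lean document; each statement's English description precedes it below -/
import Mathlib

section
/- Let A be a Poisson algebra, 𝔤 a Lie ring, and μ : 𝔤 → A an additive map satisfying μ([ξ,ζ]) = ⁅μ(ξ), μ(ζ)⁆ for all ξ, ζ ∈ 𝔤 (a comoment map). Then the ring ideal I_μ of A generated by the image of μ is closed under the Poisson bracket: for all a, b ∈ I_μ one has ⁅a, b⁆ ∈ I_μ. -/
/-- An additive map satisfying the Leibniz rule preserves the ideal spanned by `s` as soon as it
maps `s` into that ideal. -/
theorem Ideal.map_mem_span_of_leibniz {A : Type*} [CommRing A] {d : A → A} {s : Set A}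
    (hadd : ∀ a b, d (a + b) = d a + d b) (hleib : ∀ a b, d (a * b) = d a * b + a * d b)
    (hs : ∀ x ∈ s, d x ∈ Ideal.span s) {b : A} (hb : b ∈ Ideal.span s) :
    d b ∈ Ideal.span s := by
  induction hb using Submodule.span_induction with
  | mem x hx => exact hs x hx
  | zero => simp [show d 0 = 0 by simpa using hadd 0 0]
  | add x y _ _ hx hy => exact hadd x y ▸ add_mem hx hy
  | smul r x hx hdx =>
    rw [smul_eq_mul, hleib]
    exact add_mem (Ideal.mul_mem_left _ _ hx) (Ideal.mul_mem_left _ _ hdx)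

/-- For a Poisson algebra `A`, a Lie ring `𝔤`, and a comoment map `μ : 𝔤 → A`,
the ring ideal generated by the image of `μ` is closed under the Poisson bracket. -/
theorem momentum_ideal_closed_under_bracket
    {A : Type*} [CommRing A] (β : A → A → A)
    (hβ_add_left : ∀ a b c : A, β (a + b) c = β a c + β b c)
    (hβ_add_right : ∀ a b c : A, β a (b + c) = β a b + β a c)
    (hβ_alt : ∀ a : A, β a a = 0)
    (hβ_jacobi : ∀ a b c : A, β a (β b c) = β (β a b) c + β b (β a c))
    (hβ_leibniz : ∀ a b c : A, β a (b * c) = β a b * c + b * β a c)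
    {𝔤 : Type*} [LieRing 𝔤] (μ : 𝔤 → A)
    (hμ_add : ∀ ξ ζ : 𝔤, μ (ξ + ζ) = μ ξ + μ ζ)
    (hμ_bracket : ∀ ξ ζ : 𝔤, μ ⁅ξ, ζ⁆ = β (μ ξ) (μ ζ)) :
    ∀ a ∈ Ideal.span (Set.range μ), ∀ b ∈ Ideal.span (Set.range μ),
      β a b ∈ Ideal.span (Set.range μ) := by
  intro a ha b hb
  refine Ideal.map_mem_span_of_leibniz (hβ_add_right a) (hβ_leibniz a) ?_ hb
  rintro _ ⟨ζ, rfl⟩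
  have hskew : β a (μ ζ) = -β (μ ζ) a := by
    have h := hβ_alt (a + μ ζ)
    rw [hβ_add_left, hβ_add_right, hβ_add_right, hβ_alt, hβ_alt, zero_add, add_zero] at h
    exact eq_neg_of_add_eq_zero_left h
  rw [hskew]
  refine neg_mem (Ideal.map_mem_span_of_leibniz (hβ_add_right _) (hβ_leibniz _) ?_ ha)
  rintro _ ⟨ξ, rfl⟩
  exact hμ_bracket ζ ξ ▸ Ideal.subset_span ⟨_, rfl⟩
end

section
/- Let A be a Poisson algebra, 𝔤 a Lie ring, μ : 𝔤 → A a comoment map (additive with μ([ξ,ζ]) = ⁅μ(ξ), μ(ζ)⁆), and I_μ the ring ideal generated by μ(𝔤). Let A^𝔤 = {h ∈ A : ⁅μ(ξ), h⁆ = 0 for all ξ ∈ 𝔤} denote the set of invariant elements. Then A^𝔤 is closed under products and under the Poisson bracket (it is a Poisson subalgebra of A), and I_μ ∩ A^𝔤 is a Lie ideal of A^𝔤: for every h ∈ A^𝔤 and j ∈ I_μ ∩ A^𝔤, one has ⁅h, j⁆ ∈ I_μ ∩ A^𝔤. -/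
/-- The invariants `A^𝔤 = {h | ⁅μ ξ, h⁆ = 0 ∀ ξ}` form a Poisson subalgebra,
and `I_μ ∩ A^𝔤` is a Lie ideal of `A^𝔤`. -/
theorem invariants_Poisson_subalgebra_and_Lie_ideal
    {A : Type*} [CommRing A] (β : A → A → A)
    (hβ_add_left : ∀ a b c : A, β (a + b) c = β a c + β b c)
    (hβ_add_right : ∀ a b c : A, β a (b + c) = β a b + β a c)
    (hβ_alt : ∀ a : A, β a a = 0)
    (hβ_jacobi : ∀ a b c : A, β a (β b c) = β (β a b) c + β b (β a c))
    (hβ_leibniz : ∀ a b c : A, β a (b * c) = β a b * c + b * β a c)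
    {𝔤 : Type*} [LieRing 𝔤] (μ : 𝔤 → A)
    (hμ_add : ∀ ξ ζ : 𝔤, μ (ξ + ζ) = μ ξ + μ ζ)
    (hμ_bracket : ∀ ξ ζ : 𝔤, μ ⁅ξ, ζ⁆ = β (μ ξ) (μ ζ)) :
    (∀ h k : A, (∀ ξ : 𝔤, β (μ ξ) h = 0) → (∀ ξ : 𝔤, β (μ ξ) k = 0) →
      (∀ ξ : 𝔤, β (μ ξ) (h * k) = 0) ∧ (∀ ξ : 𝔤, β (μ ξ) (β h k) = 0)) ∧
    (∀ h j : A, (∀ ξ : 𝔤, β (μ ξ) h = 0) →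
      j ∈ Ideal.span (Set.range μ) → (∀ ξ : 𝔤, β (μ ξ) j = 0) →
      β h j ∈ Ideal.span (Set.range μ) ∧ ∀ ξ : 𝔤, β (μ ξ) (β h j) = 0) := by
  have zero_right (a : A) : β a 0 = 0 := by simpa using hβ_leibniz a 0 0
  have zero_left (a : A) : β 0 a = 0 := by simpa using hβ_add_left 0 0 a
  have skew (a b : A) : β a b = -β b a := by
    have h := hβ_alt (a + b)
    rw [hβ_add_left, hβ_add_right, hβ_add_right, hβ_alt, hβ_alt] at h
    linear_combination h
  have bracket_invariant (h k : A) (hh : ∀ ξ : 𝔤, β (μ ξ) h = 0)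
      (hk : ∀ ξ : 𝔤, β (μ ξ) k = 0) (ξ : 𝔤) : β (μ ξ) (β h k) = 0 := by
    rw [hβ_jacobi, hh, hk, zero_left, zero_right, add_zero]
  refine ⟨fun h k hh hk => ⟨fun ξ => ?_, bracket_invariant h k hh hk⟩,
    fun h j hh hj hj' => ⟨?_, bracket_invariant h j hh hj'⟩⟩
  · rw [hβ_leibniz, hh, hk, zero_mul, mul_zero, add_zero]
  · clear hj'
    induction hj using Submodule.span_induction with
    | mem x hx =>
      obtain ⟨ξ, rfl⟩ := hx
      rw [skew, hh, neg_zero]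
      exact zero_mem _
    | zero => exact (zero_right h).symm ▸ zero_mem _
    | add x y _ _ hx hy => exact (hβ_add_right h x y).symm ▸ add_mem hx hy
    | smul a x hx hβx =>
      rw [smul_eq_mul, hβ_leibniz]
      exact add_mem (Ideal.mul_mem_left _ _ hx) (Ideal.mul_mem_left _ _ hβx)
end

section
/- Let A be a Poisson algebra, I ⊆ A a ring ideal, F = N(I) its normalizer, and Q = {f ∈ A : ⁅f, g⁆ ∈ I for all g ∈ A}. Then Q ∩ I is a ring ideal of A (i.e. a·q ∈ Q ∩ I for all a ∈ A and q ∈ Q ∩ I), and Q ∩ I is a Lie ideal of F: for all f ∈ F and q ∈ Q ∩ I, ⁅f, q⁆ ∈ Q ∩ I. -/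
/-- `Q ∩ I` is a ring ideal of `A` and a Lie ideal of the normalizer `F = N(I)`. -/
theorem casimir_intersection_ideal
    {A : Type*} [CommRing A] (β : A → A → A)
    (hβ_add_left : ∀ a b c : A, β (a + b) c = β a c + β b c)
    (hβ_add_right : ∀ a b c : A, β a (b + c) = β a b + β a c)
    (hβ_alt : ∀ a : A, β a a = 0)
    (hβ_jacobi : ∀ a b c : A, β a (β b c) = β (β a b) c + β b (β a c))
    (hβ_leibniz : ∀ a b c : A, β a (b * c) = β a b * c + b * β a c)
    (I : Ideal A) :
    (∀ a q : A, (∀ g : A, β q g ∈ I) → q ∈ I →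
      (∀ g : A, β (a * q) g ∈ I) ∧ a * q ∈ I) ∧
    (∀ f q : A, (∀ h ∈ I, β f h ∈ I) → (∀ g : A, β q g ∈ I) → q ∈ I →
      (∀ g : A, β (β f q) g ∈ I) ∧ β f q ∈ I) := by
  have skew (a b : A) : β a b = -β b a := by
    have h := hβ_alt (a + b)
    rw [hβ_add_left, hβ_add_right, hβ_add_right, hβ_alt, hβ_alt, zero_add, add_zero] at h
    exact eq_neg_of_add_eq_zero_left h
  refine ⟨fun a q hq hqI => ⟨fun g => ?_, I.mul_mem_left a hqI⟩,
    fun f q hf hq hqI => ⟨fun g => ?_, hf q hqI⟩⟩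
  · rw [skew, hβ_leibniz, skew g q]
    exact I.neg_mem (I.add_mem (I.mul_mem_left _ hqI) (I.mul_mem_left _ (I.neg_mem (hq g))))
  · rw [eq_sub_of_add_eq (hβ_jacobi f q g).symm]
    exact I.sub_mem (hf _ (hq g)) (hq _)
end

section
/- Let A be a Poisson algebra, 𝔤 a Lie ring, μ : 𝔤 → A a comoment map (additive with μ([ξ,ζ]) = ⁅μ(ξ), μ(ζ)⁆), I ⊆ A a ring ideal with μ(ξ) ∈ I for all ξ ∈ 𝔤, I_μ the ring ideal generated by μ(𝔤), F = N(I), Q = {f ∈ A : ⁅f, g⁆ ∈ I for all g ∈ A}, and Q' = {f ∈ A : ⁅f, μ(ξ)⁆ ∈ I_μ + Q for all ξ ∈ 𝔤}, where + denotes the additive span. Then F ∩ Q' = {f ∈ F : ⁅f, j⁆ ∈ I_μ + (Q ∩ I) for all j ∈ I_μ}. -/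
/-- `F ∩ Q' = {f ∈ F : ⁅f, j⁆ ∈ I_μ + (Q ∩ I) for all j ∈ I_μ}`. -/
theorem F_inter_Qprime_characterization
    {A : Type*} [CommRing A] (β : A → A → A)
    (hβ_add_left : ∀ a b c : A, β (a + b) c = β a c + β b c)
    (hβ_add_right : ∀ a b c : A, β a (b + c) = β a b + β a c)
    (hβ_alt : ∀ a : A, β a a = 0)
    (hβ_jacobi : ∀ a b c : A, β a (β b c) = β (β a b) c + β b (β a c))
    (hβ_leibniz : ∀ a b c : A, β a (b * c) = β a b * c + b * β a c)
    {𝔤 : Type*} [LieRing 𝔤] (μ : 𝔤 → A)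
    (hμ_add : ∀ ξ ζ : 𝔤, μ (ξ + ζ) = μ ξ + μ ζ)
    (hμ_bracket : ∀ ξ ζ : 𝔤, μ ⁅ξ, ζ⁆ = β (μ ξ) (μ ζ))
    (I : Ideal A) (hμI : ∀ ξ : 𝔤, μ ξ ∈ I) :
    {f : A | (∀ h ∈ I, β f h ∈ I) ∧
        ∀ ξ : 𝔤, ∃ j ∈ Ideal.span (Set.range μ), ∃ q : A,
          (∀ g : A, β q g ∈ I) ∧ β f (μ ξ) = j + q} =
    {f : A | (∀ h ∈ I, β f h ∈ I) ∧
        ∀ j ∈ Ideal.span (Set.range μ), ∃ j' ∈ Ideal.span (Set.range μ), ∃ q : A,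
          (∀ g : A, β q g ∈ I) ∧ q ∈ I ∧ β f j = j' + q} := by
  have antisymm : ∀ a b : A, β a b = -β b a := by
    intro a b
    have h := hβ_alt (a + b)
    rw [hβ_add_left, hβ_add_right, hβ_add_right, hβ_alt, hβ_alt] at h
    linear_combination h
  have zero_right : ∀ a : A, β a 0 = 0 := by
    intro a
    simpa using hβ_add_right a 0 0
  have zero_left : ∀ a : A, β 0 a = 0 := by
    intro a
    rw [antisymm, zero_right, neg_zero]
  have span_le : Ideal.span (Set.range μ) ≤ I := by
    rw [Ideal.span_le]
    rintro _ ⟨ξ, rfl⟩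
    exact hμI ξ
  have mul_mem_Q : ∀ a q : A, (∀ g : A, β q g ∈ I) → q ∈ I → ∀ g : A, β (a * q) g ∈ I := by
    intro a q hq hqI g
    rw [antisymm, hβ_leibniz, antisymm g q]
    exact I.neg_mem (I.add_mem (I.mul_mem_left _ hqI) (I.mul_mem_left _ (I.neg_mem (hq g))))
  ext f
  simp only [Set.mem_ofPred_eq]
  refine and_congr_right fun hf => ⟨fun h j hj => ?_, fun h ξ => ?_⟩
  · induction hj using Submodule.span_induction with
    | mem x hx =>
      obtain ⟨ξ, rfl⟩ := hx
      obtain ⟨j, hj, q, hq, heq⟩ := h ξ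
      refine ⟨j, hj, q, hq, ?_, heq⟩
      have hfI := hf _ (hμI ξ)
      rw [heq] at hfI
      exact (I.add_mem_iff_right (span_le hj)).mp hfI
    | zero =>
      exact ⟨0, Ideal.zero_mem _, 0, fun g => by simp [zero_left], I.zero_mem,
        by simp [zero_right]⟩
    | add x y _ _ hx hy =>
      obtain ⟨j₁, hj₁, q₁, hq₁, hqI₁, h₁⟩ := hx
      obtain ⟨j₂, hj₂, q₂, hq₂, hqI₂, h₂⟩ := hy
      refine ⟨j₁ + j₂, Ideal.add_mem _ hj₁ hj₂, q₁ + q₂, fun g => ?_, I.add_mem hqI₁ hqI₂, ?_⟩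
      · rw [hβ_add_left]
        exact I.add_mem (hq₁ g) (hq₂ g)
      · rw [hβ_add_right, h₁, h₂]
        ring
    | smul a x hx ih =>
      obtain ⟨j, hj, q, hq, hqI, heq⟩ := ih
      refine ⟨β f a * x + a * j, Ideal.add_mem _ (Ideal.mul_mem_left _ _ hx)
        (Ideal.mul_mem_left _ _ hj), a * q, mul_mem_Q a q hq hqI, I.mul_mem_left _ hqI, ?_⟩
      rw [smul_eq_mul, hβ_leibniz, heq]
      ring
  · obtain ⟨j, hj, q, hq, -, heq⟩ := h (μ ξ) (Ideal.subset_span ⟨ξ, rfl⟩)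
    exact ⟨j, hj, q, hq, heq⟩
end

section
/- Let A be a Poisson algebra, 𝔤 a Lie ring, μ : 𝔤 → A a comoment map (additive with μ([ξ,ζ]) = ⁅μ(ξ), μ(ζ)⁆), I ⊆ A a ring ideal with μ(ξ) ∈ I for all ξ ∈ 𝔤, I_μ the ring ideal generated by μ(𝔤), F = N(I), Q = {f ∈ A : ⁅f, g⁆ ∈ I for all g ∈ A}, and Q' = {f ∈ A : ⁅f, μ(ξ)⁆ ∈ I_μ + Q for all ξ ∈ 𝔤}. Then F ∩ Q' is closed under products and under the Poisson bracket: for all f, g ∈ F ∩ Q', both f·g and ⁅f, g⁆ lie in F ∩ Q' (so F ∩ Q' is a Poisson subalgebra of A). -/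
/-- `F ∩ Q'` is closed under products and under the Poisson bracket. -/
theorem F_inter_Qprime_Poisson_subalgebra
    {A : Type*} [CommRing A] (β : A → A → A)
    (hβ_add_left : ∀ a b c : A, β (a + b) c = β a c + β b c)
    (hβ_add_right : ∀ a b c : A, β a (b + c) = β a b + β a c)
    (hβ_alt : ∀ a : A, β a a = 0)
    (hβ_jacobi : ∀ a b c : A, β a (β b c) = β (β a b) c + β b (β a c))
    (hβ_leibniz : ∀ a b c : A, β a (b * c) = β a b * c + b * β a c)
    {𝔤 : Type*} [LieRing 𝔤] (μ : 𝔤 → A)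
    (hμ_add : ∀ ξ ζ : 𝔤, μ (ξ + ζ) = μ ξ + μ ζ)
    (hμ_bracket : ∀ ξ ζ : 𝔤, μ ⁅ξ, ζ⁆ = β (μ ξ) (μ ζ))
    (I : Ideal A) (hμI : ∀ ξ : 𝔤, μ ξ ∈ I) :
    ∀ f g : A,
      ((∀ h ∈ I, β f h ∈ I) ∧
        ∀ ξ : 𝔤, ∃ j ∈ Ideal.span (Set.range μ), ∃ q : A,
          (∀ g' : A, β q g' ∈ I) ∧ β f (μ ξ) = j + q) →
      ((∀ h ∈ I, β g h ∈ I) ∧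
        ∀ ξ : 𝔤, ∃ j ∈ Ideal.span (Set.range μ), ∃ q : A,
          (∀ g' : A, β q g' ∈ I) ∧ β g (μ ξ) = j + q) →
      (((∀ h ∈ I, β (f * g) h ∈ I) ∧
        ∀ ξ : 𝔤, ∃ j ∈ Ideal.span (Set.range μ), ∃ q : A,
          (∀ g' : A, β q g' ∈ I) ∧ β (f * g) (μ ξ) = j + q) ∧
       ((∀ h ∈ I, β (β f g) h ∈ I) ∧
        ∀ ξ : 𝔤, ∃ j ∈ Ideal.span (Set.range μ), ∃ q : A,
          (∀ g' : A, β q g' ∈ I) ∧ β (β f g) (μ ξ) = j + q)) := by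
  have neg_flip : ∀ a b : A, β a b = -β b a := fun a b => by
    have h := hβ_alt (a + b)
    rw [hβ_add_left, hβ_add_right, hβ_add_right, hβ_alt, hβ_alt] at h
    linear_combination h
  have leibniz_left : ∀ a b c : A, β (a * b) c = a * β b c + β a c * b := fun a b c => by
    rw [neg_flip, hβ_leibniz, neg_flip c a, neg_flip c b]
    ring
  have jacobi_left : ∀ a b c : A, β (β a b) c = β a (β b c) - β b (β a c) := fun a b c => by
    rw [hβ_jacobi a b c]
    ring
  have map_zero_left : ∀ c : A, β 0 c = 0 := fun c => by
    have h := hβ_add_left 0 0 c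
    rw [add_zero] at h
    linear_combination -h
  have map_zero_right : ∀ c : A, β c 0 = 0 := fun c => by
    rw [neg_flip, map_zero_left, neg_zero]
  let R : Ideal A :=
    { carrier := {q | q ∈ I ∧ ∀ a, β q a ∈ I}
      zero_mem' := ⟨I.zero_mem, fun a => by rw [map_zero_left]; exact I.zero_mem⟩
      add_mem' := fun hp hq => ⟨I.add_mem hp.1 hq.1, fun a => by
        rw [hβ_add_left]; exact I.add_mem (hp.2 a) (hq.2 a)⟩
      smul_mem' := fun c q hq => ⟨I.mul_mem_left c hq.1, fun a => by
        rw [smul_eq_mul, leibniz_left]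
        exact I.add_mem (I.mul_mem_left _ (hq.2 a)) (I.mul_mem_left _ hq.1)⟩ }
  have span_le : Ideal.span (Set.range μ) ≤ I := by
    rw [Ideal.span_le]
    rintro _ ⟨ξ, rfl⟩
    exact hμI ξ
  have exists_iff : ∀ x ∈ I,
      ((∃ j ∈ Ideal.span (Set.range μ), ∃ q : A, (∀ g' : A, β q g' ∈ I) ∧ x = j + q) ↔
        x ∈ Ideal.span (Set.range μ) ⊔ R) := by
    intro x hx
    rw [Submodule.mem_sup]
    constructor
    · rintro ⟨j, hj, q, hq, rfl⟩
      exact ⟨j, hj, q, ⟨(I.add_mem_iff_right (span_le hj)).1 hx, hq⟩, rfl⟩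
    · rintro ⟨j, hj, q, hq, rfl⟩
      exact ⟨j, hj, q, hq.2, rfl⟩
  have map_sup : ∀ f : A, (∀ h ∈ I, β f h ∈ I) →
      (∀ ξ, β f (μ ξ) ∈ Ideal.span (Set.range μ) ⊔ R) →
      ∀ x ∈ Ideal.span (Set.range μ) ⊔ R, β f x ∈ Ideal.span (Set.range μ) ⊔ R := by
    intro f hf hfμ x hx
    obtain ⟨j, hj, q, hq, rfl⟩ := Submodule.mem_sup.1 hx
    clear hx
    rw [hβ_add_right]
    refine Ideal.add_mem _ ?_ (Ideal.mem_sup_right ⟨hf q hq.1, fun a => ?_⟩)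
    · induction hj using Submodule.span_induction with
      | mem x hx =>
        obtain ⟨ξ, rfl⟩ := hx
        exact hfμ ξ
      | zero => rw [map_zero_right]; exact Ideal.zero_mem _
      | add x y _ _ ihx ihy =>
        rw [hβ_add_right]
        exact Ideal.add_mem _ ihx ihy
      | smul a x hxs ih =>
        rw [smul_eq_mul, hβ_leibniz]
        exact Ideal.add_mem _ (Ideal.mul_mem_left _ _ (Ideal.mem_sup_left hxs))
          (Ideal.mul_mem_left _ _ ih)
    · rw [jacobi_left]
      exact I.sub_mem (hf _ (hq.2 a)) (hq.2 _)
  rintro f g ⟨hf, hfμ⟩ ⟨hg, hgμ⟩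
  replace hfμ := fun ξ => (exists_iff _ (hf _ (hμI ξ))).1 (hfμ ξ)
  replace hgμ := fun ξ => (exists_iff _ (hg _ (hμI ξ))).1 (hgμ ξ)
  have mul_mem : ∀ h ∈ I, β (f * g) h ∈ I := fun h hh => by
    rw [leibniz_left]
    exact I.add_mem (I.mul_mem_left _ (hg h hh)) (I.mul_mem_right _ (hf h hh))
  have bracket_mem : ∀ h ∈ I, β (β f g) h ∈ I := fun h hh => by
    rw [jacobi_left]
    exact I.sub_mem (hf _ (hg h hh)) (hg _ (hf h hh))
  refine ⟨⟨mul_mem, fun ξ => (exists_iff _ (mul_mem _ (hμI ξ))).2 ?_⟩,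
    ⟨bracket_mem, fun ξ => (exists_iff _ (bracket_mem _ (hμI ξ))).2 ?_⟩⟩
  · rw [leibniz_left]
    exact Ideal.add_mem _ (Ideal.mul_mem_left _ _ (hgμ ξ)) (Ideal.mul_mem_right _ _ (hfμ ξ))
  · rw [jacobi_left]
    exact Ideal.sub_mem _ (map_sup f hf hfμ _ (hgμ ξ)) (map_sup g hg hgμ _ (hfμ ξ))
end

section
/- Let A be a Poisson algebra, 𝔤 a Lie ring, μ : 𝔤 → A a comoment map (additive with μ([ξ,ζ]) = ⁅μ(ξ), μ(ζ)⁆), I ⊆ A a ring ideal such that μ(ξ) ∈ I and ⁅μ(ξ), h⁆ ∈ I for all ξ ∈ 𝔤 and h ∈ I (the moment elements are first class), I_μ the ring ideal generated by μ(𝔤), F = N(I), Q = {f ∈ A : ⁅f, g⁆ ∈ I for all g ∈ A}, and Q' = {f ∈ A : ⁅f, μ(ξ)⁆ ∈ I_μ + Q for all ξ ∈ 𝔤}. Then I_μ + (Q ∩ I) ⊆ F ∩ Q', and I_μ + (Q ∩ I) is a Poisson ideal of F ∩ Q': for every f ∈ F ∩ Q' and z ∈ I_μ + (Q ∩ I),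 both f·z and ⁅f, z⁆ lie in I_μ + (Q ∩ I). -/
/-- Under first-class moment elements, `I_μ + (Q ∩ I) ⊆ F ∩ Q'` and
`I_μ + (Q ∩ I)` is a Poisson ideal of `F ∩ Q'`. -/
theorem Linfty_reduction_ideal
    {A : Type*} [CommRing A] (β : A → A → A)
    (hβ_add_left : ∀ a b c : A, β (a + b) c = β a c + β b c)
    (hβ_add_right : ∀ a b c : A, β a (b + c) = β a b + β a c)
    (hβ_alt : ∀ a : A, β a a = 0)
    (hβ_jacobi : ∀ a b c : A, β a (β b c) = β (β a b) c + β b (β a c))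
    (hβ_leibniz : ∀ a b c : A, β a (b * c) = β a b * c + b * β a c)
    {𝔤 : Type*} [LieRing 𝔤] (μ : 𝔤 → A)
    (hμ_add : ∀ ξ ζ : 𝔤, μ (ξ + ζ) = μ ξ + μ ζ)
    (hμ_bracket : ∀ ξ ζ : 𝔤, μ ⁅ξ, ζ⁆ = β (μ ξ) (μ ζ))
    (I : Ideal A) (hμI : ∀ ξ : 𝔤, μ ξ ∈ I)
    (hfc : ∀ ξ : 𝔤, ∀ h ∈ I, β (μ ξ) h ∈ I) :
    (∀ z : A,
      (∃ j ∈ Ideal.span (Set.range μ), ∃ q : A,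
        (∀ g : A, β q g ∈ I) ∧ q ∈ I ∧ z = j + q) →
      ((∀ h ∈ I, β z h ∈ I) ∧
        ∀ ξ : 𝔤, ∃ j ∈ Ideal.span (Set.range μ), ∃ q : A,
          (∀ g : A, β q g ∈ I) ∧ β z (μ ξ) = j + q)) ∧
    (∀ f z : A,
      (∀ h ∈ I, β f h ∈ I) →
      (∀ ξ : 𝔤, ∃ j ∈ Ideal.span (Set.range μ), ∃ q : A,
        (∀ g : A, β q g ∈ I) ∧ β f (μ ξ) = j + q) →
      (∃ j ∈ Ideal.span (Set.range μ), ∃ q : A,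
        (∀ g : A, β q g ∈ I) ∧ q ∈ I ∧ z = j + q) →
      ((∃ j ∈ Ideal.span (Set.range μ), ∃ q : A,
        (∀ g : A, β q g ∈ I) ∧ q ∈ I ∧ f * z = j + q) ∧
       (∃ j ∈ Ideal.span (Set.range μ), ∃ q : A,
        (∀ g : A, β q g ∈ I) ∧ q ∈ I ∧ β f z = j + q))) := by
  have zero_left (a : A) : β 0 a = 0 := by simpa using hβ_add_left 0 0 a
  have zero_right (a : A) : β a 0 = 0 := by simpa using hβ_add_right a 0 0
  have skew (a b : A) : β a b = -β b a := by
    have h := hβ_alt (a + b)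
    rw [hβ_add_left, hβ_add_right, hβ_add_right, hβ_alt, hβ_alt] at h
    linear_combination h
  have leibniz_left (a b c : A) : β (a * b) c = β a c * b + a * β b c := by
    rw [skew, hβ_leibniz, skew c a, skew c b]
    ring
  have jacobi_left (a b c : A) : β (β a b) c = β a (β b c) - β b (β a c) := by
    rw [hβ_jacobi a b c]
    ring
  -- `Q ∩ I` as an ideal of `A`
  let K : Ideal A :=
    { carrier := {q | (∀ g, β q g ∈ I) ∧ q ∈ I}
      zero_mem' := ⟨fun g => by simp [zero_left], I.zero_mem⟩
      add_mem' := fun {a b} ha hb =>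
        ⟨fun g => by rw [hβ_add_left]; exact I.add_mem (ha.1 g) (hb.1 g), I.add_mem ha.2 hb.2⟩
      smul_mem' := fun c x hx =>
        ⟨fun g => by
          rw [smul_eq_mul, leibniz_left]
          exact I.add_mem (I.mul_mem_left _ hx.2) (I.mul_mem_left _ (hx.1 g)),
        I.mul_mem_left _ hx.2⟩ }
  have mem_iff (z : A) : (∃ j ∈ Ideal.span (Set.range μ), ∃ q : A,
      (∀ g : A, β q g ∈ I) ∧ q ∈ I ∧ z = j + q) ↔ z ∈ Ideal.span (Set.range μ) ⊔ K := by
    rw [Submodule.mem_sup]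
    constructor
    · rintro ⟨j, hj, q, hq, hqI, rfl⟩
      exact ⟨j, hj, q, ⟨hq, hqI⟩, rfl⟩
    · rintro ⟨j, hj, q, ⟨hq, hqI⟩, rfl⟩
      exact ⟨j, hj, q, hq, hqI, rfl⟩
  have span_le : Ideal.span (Set.range μ) ≤ I := by
    rw [Ideal.span_le]
    rintro _ ⟨ξ, rfl⟩
    exact hμI ξ
  have μ_mem (ξ : 𝔤) : μ ξ ∈ Ideal.span (Set.range μ) := Ideal.subset_span ⟨ξ, rfl⟩
  have span_normalizes (j : A) (hj : j ∈ Ideal.span (Set.range μ)) : ∀ h ∈ I, β j h ∈ I := by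
    intro h hh
    induction hj using Submodule.span_induction with
    | mem x hx =>
      obtain ⟨ξ, rfl⟩ := hx
      exact hfc ξ h hh
    | zero => simp [zero_left]
    | add x y _ _ hx hy =>
      rw [hβ_add_left]
      exact I.add_mem hx hy
    | smul a x hxs hx =>
      rw [smul_eq_mul, leibniz_left]
      exact I.add_mem (I.mul_mem_left _ (span_le hxs)) (I.mul_mem_left _ hx)
  have span_bracket (j : A) (hj : j ∈ Ideal.span (Set.range μ)) (ξ : 𝔤) :
      β j (μ ξ) ∈ Ideal.span (Set.range μ) := by
    induction hj using Submodule.span_induction with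
    | mem x hx =>
      obtain ⟨ζ, rfl⟩ := hx
      rw [← hμ_bracket]
      exact μ_mem _
    | zero => simp [zero_left]
    | add x y _ _ hx hy =>
      rw [hβ_add_left]
      exact Ideal.add_mem _ hx hy
    | smul a x hxs hx =>
      rw [smul_eq_mul, leibniz_left]
      exact Ideal.add_mem _ (Ideal.mul_mem_left _ _ hxs) (Ideal.mul_mem_left _ _ hx)
  refine ⟨?_, ?_⟩
  · rintro _ ⟨j, hj, q, hq, hqI, rfl⟩
    refine ⟨fun h hh => ?_, fun ξ =>
      ⟨β j (μ ξ), span_bracket j hj ξ, β q (μ ξ), fun g => ?_, hβ_add_left _ _ _⟩⟩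
    · rw [hβ_add_left]
      exact I.add_mem (span_normalizes j hj h hh) (hq h)
    · rw [jacobi_left]
      exact I.sub_mem (hq _) (hfc ξ _ (hq g))
  · intro f z hfF hfQ hz
    simp only [mem_iff] at hz ⊢
    refine ⟨Ideal.mul_mem_left _ _ hz, ?_⟩
    obtain ⟨j, hj, q, ⟨hq, hqI⟩, rfl⟩ := Submodule.mem_sup.1 hz
    rw [hβ_add_right]
    refine Ideal.add_mem _ ?_ (Ideal.mem_sup_right ⟨fun g => ?_, hfF q hqI⟩)
    · clear hz
      induction hj using Submodule.span_induction with
      | mem x hx =>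
        obtain ⟨ξ, rfl⟩ := hx
        obtain ⟨i, hi, p, hp, h⟩ := hfQ ξ
        have hpI : p ∈ I := by
          rw [← I.add_mem_iff_right (span_le hi), ← h]
          exact hfF _ (hμI ξ)
        exact (mem_iff _).1 ⟨i, hi, p, hp, hpI, h⟩
      | zero => simp [zero_right]
      | add x y _ _ hx hy =>
        rw [hβ_add_right]
        exact Ideal.add_mem _ hx hy
      | smul a x hxs hx =>
        rw [smul_eq_mul, hβ_leibniz]
        exact Ideal.add_mem _ (Ideal.mul_mem_left _ _ (Ideal.mem_sup_left hxs))
          (Ideal.mul_mem_left _ _ hx)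
    · rw [jacobi_left]
      exact I.sub_mem (hfF _ (hq g)) (hq _)
end

section
/- Let A be a Poisson algebra, 𝔤 a Lie ring, μ : 𝔤 → A a comoment map (additive with μ([ξ,ζ]) = ⁅μ(ξ), μ(ζ)⁆), I ⊆ A a ring ideal with μ(ξ) ∈ I for all ξ ∈ 𝔤, I_μ the ring ideal generated by μ(𝔤), F = N(I), Q = {f ∈ A : ⁅f, g⁆ ∈ I for all g ∈ A}, and Q' = {f ∈ A : ⁅f, μ(ξ)⁆ ∈ I_μ + Q for all ξ ∈ 𝔤}. If Q ∩ I ⊆ I_μ, then F ∩ Q' = F ∩ N(I_μ). -/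
/-- If `Q ∩ I ⊆ I_μ`, then `F ∩ Q' = F ∩ N(I_μ)`. -/
theorem F_inter_Qprime_eq_F_inter_normalizer
    {A : Type*} [CommRing A] (β : A → A → A)
    (hβ_add_left : ∀ a b c : A, β (a + b) c = β a c + β b c)
    (hβ_add_right : ∀ a b c : A, β a (b + c) = β a b + β a c)
    (hβ_alt : ∀ a : A, β a a = 0)
    (hβ_jacobi : ∀ a b c : A, β a (β b c) = β (β a b) c + β b (β a c))
    (hβ_leibniz : ∀ a b c : A, β a (b * c) = β a b * c + b * β a c)
    {𝔤 : Type*} [LieRing 𝔤] (μ : 𝔤 → A)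
    (hμ_add : ∀ ξ ζ : 𝔤, μ (ξ + ζ) = μ ξ + μ ζ)
    (hμ_bracket : ∀ ξ ζ : 𝔤, μ ⁅ξ, ζ⁆ = β (μ ξ) (μ ζ))
    (I : Ideal A) (hμI : ∀ ξ : 𝔤, μ ξ ∈ I)
    (hQI : ∀ q : A, (∀ g : A, β q g ∈ I) → q ∈ I → q ∈ Ideal.span (Set.range μ)) :
    {f : A | (∀ h ∈ I, β f h ∈ I) ∧
        ∀ ξ : 𝔤, ∃ j ∈ Ideal.span (Set.range μ), ∃ q : A,
          (∀ g : A, β q g ∈ I) ∧ β f (μ ξ) = j + q} =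
    {f : A | (∀ h ∈ I, β f h ∈ I) ∧
        ∀ j ∈ Ideal.span (Set.range μ), β f j ∈ Ideal.span (Set.range μ)} := by
  have hμ_span : Ideal.span (Set.range μ) ≤ I :=
    Ideal.span_le.2 (Set.range_subset_iff.2 hμI)
  have hβ_zero_left (g : A) : β 0 g = 0 := by simpa using hβ_add_left 0 0 g
  have hβ_zero_right (f : A) : β f 0 = 0 := by simpa using hβ_add_right f 0 0
  ext f
  refine and_congr_right fun hf ↦ ⟨fun h j hj ↦ ?_, fun h ξ ↦ ?_⟩
  · induction hj using Submodule.span_induction with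
    | mem x hx =>
      obtain ⟨ξ, rfl⟩ := hx
      obtain ⟨j, hj, q, hq, hfq⟩ := h ξ
      have hqI : q ∈ I :=
        (I.add_mem_iff_right (hμ_span hj)).1 (hfq ▸ hf _ (hμI ξ))
      exact hfq ▸ add_mem hj (hQI q hq hqI)
    | zero => simp [hβ_zero_right]
    | add x y _ _ hx hy => exact hβ_add_right f x y ▸ add_mem hx hy
    | smul a x hx ih =>
      rw [smul_eq_mul, hβ_leibniz]
      exact add_mem (Ideal.mul_mem_left _ _ hx) (Ideal.mul_mem_left _ _ ih)
  · exact ⟨_, h _ (Ideal.subset_span ⟨ξ, rfl⟩), 0, by simp [hβ_zero_left], by simp⟩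
end

section
/- Let A be a Poisson algebra, 𝔤 a Lie ring, μ : 𝔤 → A a comoment map (additive with μ([ξ,ζ]) = ⁅μ(ξ), μ(ζ)⁆), and I ⊆ A a ring ideal such that μ(ξ) ∈ I and ⁅μ(ξ), h⁆ ∈ I for all ξ ∈ 𝔤 and all h ∈ I. Then the ring ideal I_μ generated by μ(𝔤) consists of first-class elements: ⁅j, h⁆ ∈ I for all j ∈ I_μ and h ∈ I, i.e. I_μ ⊆ N(I). -/
/-- If each `μ ξ` lies in `I` and is first class, then the whole momentum
ideal `I_μ` consists of first-class elements, i.e. `I_μ ⊆ N(I)`. -/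
theorem momentum_ideal_first_class
    {A : Type*} [CommRing A] (β : A → A → A)
    (hβ_add_left : ∀ a b c : A, β (a + b) c = β a c + β b c)
    (hβ_add_right : ∀ a b c : A, β a (b + c) = β a b + β a c)
    (hβ_alt : ∀ a : A, β a a = 0)
    (hβ_jacobi : ∀ a b c : A, β a (β b c) = β (β a b) c + β b (β a c))
    (hβ_leibniz : ∀ a b c : A, β a (b * c) = β a b * c + b * β a c)
    {𝔤 : Type*} [LieRing 𝔤] (μ : 𝔤 → A)
    (hμ_add : ∀ ξ ζ : 𝔤, μ (ξ + ζ) = μ ξ + μ ζ)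
    (hμ_bracket : ∀ ξ ζ : 𝔤, μ ⁅ξ, ζ⁆ = β (μ ξ) (μ ζ))
    (I : Ideal A) (hμI : ∀ ξ : 𝔤, μ ξ ∈ I)
    (hfc : ∀ ξ : 𝔤, ∀ h ∈ I, β (μ ξ) h ∈ I) :
    ∀ j ∈ Ideal.span (Set.range μ), ∀ h ∈ I, β j h ∈ I := by
  have hskew : ∀ a b : A, β a b = -β b a := fun a b ↦ by
    have h := hβ_alt (a + b)
    rw [hβ_add_left, hβ_add_right, hβ_add_right, hβ_alt, hβ_alt] at h
    linear_combination h
  have hspan : Ideal.span (Set.range μ) ≤ I :=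
    Ideal.span_le.2 (Set.range_subset_iff.2 hμI)
  intro j hj
  induction hj using Submodule.span_induction with
  | mem x hx =>
    obtain ⟨ξ, rfl⟩ := hx
    exact hfc ξ
  | zero =>
    intro h _
    have h0 : β 0 h = 0 := by simpa using hβ_add_left 0 0 h
    rw [h0]
    exact I.zero_mem
  | add x y _ _ ihx ihy =>
    intro h hh
    rw [hβ_add_left]
    exact I.add_mem (ihx h hh) (ihy h hh)
  | smul a x hx ih =>
    intro h hh
    have key : β (a • x) h = β a h * x + a * β x h := by
      rw [smul_eq_mul, hskew, hβ_leibniz, hskew h a, hskew h x]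
      ring
    rw [key]
    exact I.add_mem (I.mul_mem_left _ (hspan hx)) (I.mul_mem_left _ (ih h hh))
end

section
/- Let A be a Poisson algebra, 𝔤 a Lie ring, μ : 𝔤 → A a comoment map (additive with μ([ξ,ζ]) = ⁅μ(ξ), μ(ζ)⁆), and I ⊆ A a ring ideal such that μ(ξ) ∈ I and ⁅μ(ξ), h⁆ ∈ I for all ξ ∈ 𝔤 and h ∈ I. Let I_μ be the ring ideal generated by μ(𝔤) and Q = {f ∈ A : ⁅f, g⁆ ∈ I for all g ∈ A}. Then ⁅q, j⁆ ∈ Q ∩ I for every q ∈ Q ∩ I and j ∈ I_μ. -/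
/-- For `q ∈ Q ∩ I` and `j ∈ I_μ`, one has `⁅q, j⁆ ∈ Q ∩ I`. -/
theorem casimir_bracket_momentum
    {A : Type*} [CommRing A] (β : A → A → A)
    (hβ_add_left : ∀ a b c : A, β (a + b) c = β a c + β b c)
    (hβ_add_right : ∀ a b c : A, β a (b + c) = β a b + β a c)
    (hβ_alt : ∀ a : A, β a a = 0)
    (hβ_jacobi : ∀ a b c : A, β a (β b c) = β (β a b) c + β b (β a c))
    (hβ_leibniz : ∀ a b c : A, β a (b * c) = β a b * c + b * β a c)
    {𝔤 : Type*} [LieRing 𝔤] (μ : 𝔤 → A)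
    (hμ_add : ∀ ξ ζ : 𝔤, μ (ξ + ζ) = μ ξ + μ ζ)
    (hμ_bracket : ∀ ξ ζ : 𝔤, μ ⁅ξ, ζ⁆ = β (μ ξ) (μ ζ))
    (I : Ideal A) (hμI : ∀ ξ : 𝔤, μ ξ ∈ I)
    (hfc : ∀ ξ : 𝔤, ∀ h ∈ I, β (μ ξ) h ∈ I) :
    ∀ q j : A, (∀ g : A, β q g ∈ I) → q ∈ I → j ∈ Ideal.span (Set.range μ) →
      (∀ g : A, β (β q j) g ∈ I) ∧ β q j ∈ I := by
  intro q j hq _ hj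
  refine ⟨?_, hq j⟩
  have anti (a b : A) : β a b = -β b a := by
    have h := hβ_alt (a + b)
    rw [hβ_add_left, hβ_add_right, hβ_add_right, hβ_alt, hβ_alt] at h
    linear_combination h
  have leibniz_left (a b c : A) : β (a * b) c = β a c * b + a * β b c := by
    rw [anti, hβ_leibniz, anti c a, anti c b]
    ring
  have zero_left (c : A) : β 0 c = 0 := by
    simpa using hβ_add_left 0 0 c
  have span_le : Ideal.span (Set.range μ) ≤ I := by
    rw [Ideal.span_le]
    rintro _ ⟨ξ, rfl⟩
    exact hμI ξ
  induction hj using Submodule.span_induction with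
  | mem x hx =>
    obtain ⟨ξ, rfl⟩ := hx
    intro g
    have h : β (β q (μ ξ)) g = β q (β (μ ξ) g) - β (μ ξ) (β q g) := by
      rw [hβ_jacobi q (μ ξ) g]
      ring
    rw [h]
    exact I.sub_mem (hq _) (hfc ξ _ (hq g))
  | zero =>
    intro g
    rw [anti q 0, zero_left, neg_zero, zero_left]
    exact I.zero_mem
  | add x y _ _ hx hy =>
    intro g
    rw [hβ_add_right, hβ_add_left]
    exact I.add_mem (hx g) (hy g)
  | smul a x hxs hx =>
    intro g
    rw [smul_eq_mul, hβ_leibniz, hβ_add_left, leibniz_left, leibniz_left]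
    exact I.add_mem
      (I.add_mem (I.mul_mem_left _ (span_le hxs)) (I.mul_mem_right _ (hq a)))
      (I.add_mem (I.mul_mem_left _ (hq x)) (I.mul_mem_left _ (hx g)))
end

section
/- Let f : ℝ × ℝ → ℝ be infinitely differentiable and suppose f vanishes on the coordinate cross, i.e. f(x, y) = 0 whenever x·y = 0 (equivalently, f(x, 0) = 0 and f(0, y) = 0 for all x, y ∈ ℝ). Then there exists an infinitely differentiable function h : ℝ × ℝ → ℝ such that f(x, y) = x·y·h(x, y) for all (x, y) ∈ ℝ × ℝ. (In other words, the vanishing ideal of the coordinate cross N = {(x,y) : xy = 0} in C^∞(ℝ²) is the principal ideal generated by the function (x, y) ↦ x·y.) -/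
open Set Filter Topology MeasureTheory

universe u

section ParametricIntegral

variable {E G : Type u} [NormedAddCommGroup E] [NormedSpace ℝ E] [ProperSpace E]
  [NormedAddCommGroup G] [NormedSpace ℝ G]

/-- Differentiation under the integral sign for a `C¹` integrand over a compact interval. -/
theorem hasFDerivAt_intervalIntegral_of_contDiff {H : E × ℝ → G} (hH : ContDiff ℝ 1 H)
    (a b : ℝ) (x : E) :
    HasFDerivAt (fun x => ∫ t in a..b, H (x, t))
      (∫ t in a..b, (fderiv ℝ H (x, t)).comp (ContinuousLinearMap.inl ℝ E ℝ)) x := by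
  have hcont : Continuous fun p => (fderiv ℝ H p).comp (ContinuousLinearMap.inl ℝ E ℝ) :=
    (hH.continuous_fderiv one_ne_zero).clm_comp continuous_const
  obtain ⟨C, hC⟩ := ((isCompact_closedBall x 1).prod
    (isCompact_uIcc (a := a) (b := b))).exists_bound_of_continuousOn hcont.continuousOn
  have hslice (x : E) : Continuous fun t => H (x, t) :=
    hH.continuous.comp (Continuous.prodMk_right x)
  refine intervalIntegral.hasFDerivAt_integral_of_dominated_of_fderiv_le (𝕜 := ℝ)
    (F' := fun x t => (fderiv ℝ H (x, t)).comp (ContinuousLinearMap.inl ℝ E ℝ))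
    (bound := fun _ => C) (Metric.closedBall_mem_nhds x one_pos)
    (.of_forall fun x => (hslice x).aestronglyMeasurable)
    ((hslice x).intervalIntegrable a b)
    (hcont.comp (Continuous.prodMk_right x)).aestronglyMeasurable
    (.of_forall fun t ht y hy => hC (y, t) ⟨hy, uIoc_subset_uIcc ht⟩)
    intervalIntegrable_const (.of_forall fun t _ y _ => ?_)
  exact (hH.differentiable one_ne_zero (y, t)).hasFDerivAt.comp y (hasFDerivAt_prodMk_left y t)

end ParametricIntegral

theorem ContDiff.intervalIntegral_natCast {E : Type u} [NormedAddCommGroup E] [NormedSpace ℝ E]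
    [ProperSpace E] (a b : ℝ) (n : ℕ) :
    ∀ {G : Type u} [NormedAddCommGroup G] [NormedSpace ℝ G] {H : E × ℝ → G},
      ContDiff ℝ n H → ContDiff ℝ n fun x => ∫ t in a..b, H (x, t) := by
  induction n with
  | zero =>
    intro G _ _ H hH
    simp only [Nat.cast_zero, contDiff_zero] at hH ⊢
    exact intervalIntegral.continuous_parametric_intervalIntegral_of_continuous'
      (f := fun x t => H (x, t)) hH a b
  | succ n ih =>
    intro G _ _ H hH
    push_cast at hH ⊢
    refine contDiff_succ_iff_hasFDerivAt.2 ⟨_, ih (H := fun p =>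
      (fderiv ℝ H p).comp (ContinuousLinearMap.inl ℝ E ℝ)) ?_, fun x =>
      hasFDerivAt_intervalIntegral_of_contDiff (hH.of_le (by simp)) a b x⟩
    exact (hH.fderiv_right le_rfl).clm_comp contDiff_const

/-- The integral over a compact interval of a smooth function of `(x, t)` is smooth in `x`. -/
theorem ContDiff.intervalIntegral_infty {E G : Type u} [NormedAddCommGroup E] [NormedSpace ℝ E]
    [ProperSpace E] [NormedAddCommGroup G] [NormedSpace ℝ G] {H : E × ℝ → G}
    (hH : ContDiff ℝ (⊤ : ℕ∞) H) (a b : ℝ) :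
    ContDiff ℝ (⊤ : ℕ∞) fun x => ∫ t in a..b, H (x, t) :=
  contDiff_infty.2 fun n => .intervalIntegral_natCast a b n (contDiff_infty.1 hH n)

/-- **Hadamard's lemma** for a hyperplane: a smooth function vanishing on the kernel of a
continuous linear functional `l` is a smooth multiple of `l`. -/
theorem ContDiff.exists_eq_smul_of_eq_zero_on_ker {E G : Type u} [NormedAddCommGroup E]
    [NormedSpace ℝ E] [ProperSpace E] [NormedAddCommGroup G] [NormedSpace ℝ G] [CompleteSpace G]
    {f : E → G} (hf : ContDiff ℝ (⊤ : ℕ∞) f) (l : E →L[ℝ] ℝ) {v : E} (hv : l v = 1)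
    (hzero : ∀ x, l x = 0 → f x = 0) :
    ∃ g : E → G, ContDiff ℝ (⊤ : ℕ∞) g ∧ ∀ x, f x = l x • g x := by
  refine ⟨fun x => ∫ t in (0 : ℝ)..1, fderiv ℝ f (x - l x • v + t • l x • v) v,
    ContDiff.intervalIntegral_infty
      (H := fun p : E × ℝ => fderiv ℝ f (p.1 - l p.1 • v + p.2 • l p.1 • v) v) ?_ 0 1,
    fun x => ?_⟩
  · have hf' : ContDiff ℝ (⊤ : ℕ∞) (fderiv ℝ f) := hf.fderiv_right (by simp)
    exact (hf'.comp (by fun_prop)).clm_apply contDiff_const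
  · have hderiv (t : ℝ) : HasDerivAt (fun t : ℝ => f (x - l x • v + t • l x • v))
        (l x • fderiv ℝ f (x - l x • v + t • l x • v) v) t := by
      have hline : HasDerivAt (fun t : ℝ => x - l x • v + t • l x • v) (l x • v) t := by
        simpa using ((hasDerivAt_id t).smul_const (l x • v)).const_add (x - l x • v)
      simpa [Function.comp_def] using
        (hf.differentiable (by simp) _).hasFDerivAt.comp_hasDerivAt t hline
    have hcont : Continuous fun t : ℝ => l x • fderiv ℝ f (x - l x • v + t • l x • v) v := by
      have := hf.continuous_fderiv (by simp)
      fun_prop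
    rw [← intervalIntegral.integral_smul,
      intervalIntegral.integral_eq_sub_of_hasDerivAt (fun t _ => hderiv t)
        (hcont.intervalIntegrable 0 1)]
    simp [hzero (x - l x • v) (by simp [hv])]

/-- A smooth function on `ℝ²` vanishing on the coordinate cross `{xy = 0}`
is a smooth multiple of `x·y`. -/
theorem vanishing_ideal_of_coordinate_cross
    (f : ℝ × ℝ → ℝ) (hf : ContDiff ℝ (⊤ : ℕ∞) f)
    (hvanish : ∀ p : ℝ × ℝ, p.1 * p.2 = 0 → f p = 0) :
    ∃ h : ℝ × ℝ → ℝ, ContDiff ℝ (⊤ : ℕ∞) h ∧ ∀ p : ℝ × ℝ, f p = p.1 * p.2 * h p := by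
  obtain ⟨g, hg, hfg⟩ := hf.exists_eq_smul_of_eq_zero_on_ker (ContinuousLinearMap.fst ℝ ℝ ℝ)
    (v := (1, 0)) rfl fun p (hp : p.1 = 0) => hvanish p (by simp [hp])
  have hg_axis : (fun x : ℝ => g (x, 0)) = fun _ => 0 := by
    refine Continuous.ext_on (dense_compl_singleton (0 : ℝ))
      (hg.continuous.comp (Continuous.prodMk_left 0)) continuous_const fun x hx => ?_
    have hmul : x * g (x, 0) = 0 := (hfg (x, 0)).symm.trans (hvanish _ (mul_zero x))
    exact (mul_eq_zero.1 hmul).resolve_left hx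
  obtain ⟨h, hh, hgh⟩ := hg.exists_eq_smul_of_eq_zero_on_ker (ContinuousLinearMap.snd ℝ ℝ ℝ)
    (v := (0, 1)) rfl fun p (hp : p.2 = 0) =>
      (congrArg g (Prod.ext rfl hp : p = (p.1, 0))).trans (congrFun hg_axis p.1)
  refine ⟨h, hh, fun p => ?_⟩
  rw [hfg, hgh]
  simp [mul_assoc]
end
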